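/- (Rational Quotient Lemma) If ≲ is a precongruence on a rational cartesian closed category C, then the quotient category C/≲ — with the same objects, hom-posets C(A,B)/≃ ordered by [f] ≤ [g] iff f ≲ g, and composition, pairing and currying defined on equivalence classes by [g]∘[f] = [g∘f], ⟨[f],[g]⟩ = [⟨f,g⟩], Λ([f]) = [Λ(f)] — is again a rational cartesian closed category. -/

import Mathlib

universe u v

/-- A rational cartesian closed category, presented concretely over a fixed
type of objects, hom-types, and chosen terminal object, products and
exponentials.  It is ppo-enriched (every hom-set is a pointed poset,
composition/pairing/currying are monotone and composition is left-strict),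
and rational: the chain of approximants `f^(k)` of any `f : A × B → B` has a
least upper bound `f^∇`, and `h ∘ f^∇ ∘ g = ⊔_k h ∘ f^(k) ∘ g` for all
`g : C → A`, `h : B → D`. -/
structure RationalCCC (Obj : Type u) (Hom : Obj → Obj → Type v)
    (one : Obj) (prod : Obj → Obj → Obj) (exp : Obj → Obj → Obj) :
    Type (max u v) where
  id : ∀ A, Hom A A
  comp : ∀ {A B C : Obj}, Hom B C → Hom A B → Hom A C
  id_comp : ∀ {A B : Obj} (f : Hom A B), comp (id B) f = f
  comp_id : ∀ {A B : Obj} (f : Hom A B), comp f (id A) = f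
  assoc : ∀ {A B C D : Obj} (h : Hom C D) (g : Hom B C) (f : Hom A B),
      comp (comp h g) f = comp h (comp g f)
  -- terminal object
  bang : ∀ A, Hom A one
  bang_unique : ∀ {A : Obj} (f : Hom A one), f = bang A
  -- binary products
  fst : ∀ {A B : Obj}, Hom (prod A B) A
  snd : ∀ {A B : Obj}, Hom (prod A B) B
  pair : ∀ {C A B : Obj}, Hom C A → Hom C B → Hom C (prod A B)
  fst_pair : ∀ {C A B : Obj} (f : Hom C A) (g : Hom C B), comp fst (pair f g) = f
  snd_pair : ∀ {C A B : Obj} (f : Hom C A) (g : Hom C B), comp snd (pair f g) = g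
  pair_unique : ∀ {C A B : Obj} (f : Hom C A) (g : Hom C B) (h : Hom C (prod A B)),
      comp fst h = f → comp snd h = g → h = pair f g
  -- exponentials
  eval : ∀ {A B : Obj}, Hom (prod (exp A B) A) B
  curry : ∀ {C A B : Obj}, Hom (prod C A) B → Hom C (exp A B)
  eval_curry : ∀ {C A B : Obj} (f : Hom (prod C A) B),
      comp eval (pair (comp (curry f) fst) snd) = f
  curry_unique : ∀ {C A B : Obj} (f : Hom (prod C A) B) (h : Hom C (exp A B)),
      comp eval (pair (comp h fst) snd) = f → h = curry f
  -- ppo-enrichment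
  le : ∀ {A B : Obj}, Hom A B → Hom A B → Prop
  le_refl : ∀ {A B : Obj} (f : Hom A B), le f f
  le_trans : ∀ {A B : Obj} {f g h : Hom A B}, le f g → le g h → le f h
  le_antisymm : ∀ {A B : Obj} {f g : Hom A B}, le f g → le g f → f = g
  bot : ∀ {A B : Obj}, Hom A B
  bot_le : ∀ {A B : Obj} (f : Hom A B), le bot f
  comp_mono : ∀ {A B C : Obj} {g g' : Hom B C} {f f' : Hom A B},
      le g g' → le f f' → le (comp g f) (comp g' f')
  pair_mono : ∀ {C A B : Obj} {f f' : Hom C A} {g g' : Hom C B},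
      le f f' → le g g' → le (pair f g) (pair f' g')
  curry_mono : ∀ {C A B : Obj} {f g : Hom (prod C A) B},
      le f g → le (curry f) (curry g)
  bot_comp : ∀ {A B C : Obj} (f : Hom A B), comp (bot : Hom B C) f = (bot : Hom A C)
  -- rationality
  iter : ∀ {A B : Obj}, Hom (prod A B) B → ℕ → Hom A B
  iter_zero : ∀ {A B : Obj} (f : Hom (prod A B) B), iter f 0 = bot
  iter_succ : ∀ {A B : Obj} (f : Hom (prod A B) B) (k : ℕ),
      iter f (k + 1) = comp f (pair (id A) (iter f k))
  fix : ∀ {A B : Obj}, Hom (prod A B) B → Hom A B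
  fix_lub : ∀ {A B C D : Obj} (f : Hom (prod A B) B) (g : Hom C A) (h : Hom B D),
      (∀ k, le (comp h (comp (iter f k) g)) (comp h (comp (fix f) g))) ∧
      (∀ u : Hom C D, (∀ k, le (comp h (comp (iter f k) g)) u) →
        le (comp h (comp (fix f) g)) u)

/-- A precongruence `≲` on a rational CCC: a family of preorders on the
hom-sets, compatible with composition, pairing and currying, containing the
enrichment order, and closed under the rational fixed-point rule (r6). -/
structure Precongruence {Obj : Type u} {Hom : Obj → Obj → Type v}
    {one : Obj} {prod exp : Obj → Obj → Obj}
    (C : RationalCCC Obj Hom one prod exp) : Type (max u v) where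
  r : ∀ {A B : Obj}, Hom A B → Hom A B → Prop
  r_refl : ∀ {A B : Obj} (f : Hom A B), r f f
  r_trans : ∀ {A B : Obj} {f g h : Hom A B}, r f g → r g h → r f h
  comp_congr : ∀ {A B C' : Obj} {g g' : Hom B C'} {f f' : Hom A B},
      r g g' → r f f' → r (C.comp g f) (C.comp g' f')
  pair_congr : ∀ {C' A B : Obj} {f f' : Hom C' A} {g g' : Hom C' B},
      r f f' → r g g' → r (C.pair f g) (C.pair f' g')
  curry_congr : ∀ {C' A B : Obj} {f g : Hom (prod C' A) B},
      r f g → r (C.curry f) (C.curry g)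
  le_sub : ∀ {A B : Obj} {f g : Hom A B}, C.le f g → r f g
  rat_closed : ∀ {A B C' D : Obj} (f : Hom (prod A B) B) (g : Hom C' A)
      (h : Hom B D) (k : Hom C' D),
      (∀ n, r (C.comp h (C.comp (C.iter f n) g)) k) →
      r (C.comp h (C.comp (C.fix f) g)) k

/-- The equivalence `≃` induced by a precongruence, as a setoid on each
hom-set. -/
def Precongruence.setoid {Obj : Type u} {Hom : Obj → Obj → Type v}
    {one : Obj} {prod exp : Obj → Obj → Obj}
    {C : RationalCCC Obj Hom one prod exp} (R : Precongruence C)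
    (A B : Obj) : Setoid (Hom A B) where
  r f g := R.r f g ∧ R.r g f
  iseqv := ⟨fun f => ⟨R.r_refl f, R.r_refl f⟩, fun h => ⟨h.2, h.1⟩,
    fun h1 h2 => ⟨R.r_trans h1.1 h2.1, R.r_trans h2.2 h1.2⟩⟩

namespace RationalCCC

variable {Obj : Type u} {Hom : Obj → Obj → Type v} {one : Obj} {prod exp : Obj → Obj → Obj}
  (C : RationalCCC Obj Hom one prod exp)

theorem pair_eta {A B X : Obj} (h : Hom X (prod A B)) :
    C.pair (C.comp C.fst h) (C.comp C.snd h) = h :=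
  (C.pair_unique _ _ h rfl rfl).symm

theorem curry_eta {A B X : Obj} (h : Hom X (exp A B)) :
    C.curry (C.comp C.eval (C.pair (C.comp h C.fst) C.snd)) = h :=
  (C.curry_unique _ h rfl).symm

theorem iter_le_fix {A B : Obj} (f : Hom (prod A B) B) (k : ℕ) :
    C.le (C.iter f k) (C.fix f) := by
  simpa only [C.comp_id, C.id_comp] using (C.fix_lub f (C.id A) (C.id B)).1 k

end RationalCCC

namespace Precongruence

variable {Obj : Type u} {Hom : Obj → Obj → Type v} {one : Obj} {prod exp : Obj → Obj → Obj}
  {C : RationalCCC Obj Hom one prod exp} (R : Precongruence C)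

theorem iter_congr {A B : Obj} {f g : Hom (prod A B) B} (h : R.r f g) (k : ℕ) :
    R.r (C.iter f k) (C.iter g k) := by
  induction k with
  | zero => simpa only [C.iter_zero] using R.r_refl _
  | succ k ih =>
    simpa only [C.iter_succ] using R.comp_congr h (R.pair_congr (R.r_refl _) ih)

theorem fix_le {A B : Obj} {f : Hom (prod A B) B} {u : Hom A B}
    (h : ∀ k, R.r (C.iter f k) u) : R.r (C.fix f) u := by
  simpa only [C.comp_id, C.id_comp] using
    R.rat_closed f (C.id A) (C.id B) u (by simpa only [C.comp_id, C.id_comp] using h)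

theorem fix_congr {A B : Obj} {f g : Hom (prod A B) B} (h : R.r f g) :
    R.r (C.fix f) (C.fix g) :=
  R.fix_le fun k => R.r_trans (R.iter_congr h k) (R.le_sub (C.iter_le_fix g k))

/-- The quotient of a rational cartesian closed category by a precongruence. -/
def quotient : RationalCCC Obj (fun A B => Quotient (R.setoid A B)) one prod exp where
  id A := Quotient.mk _ (C.id A)
  comp := Quotient.map₂ C.comp fun _ _ hg _ _ hf =>
    ⟨R.comp_congr hg.1 hf.1, R.comp_congr hg.2 hf.2⟩
  id_comp := by
    rintro A B ⟨f⟩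
    exact congrArg (Quotient.mk _) (C.id_comp f)
  comp_id := by
    rintro A B ⟨f⟩
    exact congrArg (Quotient.mk _) (C.comp_id f)
  assoc := by
    rintro A B X Y ⟨h⟩ ⟨g⟩ ⟨f⟩
    exact congrArg (Quotient.mk _) (C.assoc h g f)
  bang A := Quotient.mk _ (C.bang A)
  bang_unique := by
    rintro A ⟨f⟩
    exact congrArg (Quotient.mk _) (C.bang_unique f)
  fst := Quotient.mk _ C.fst
  snd := Quotient.mk _ C.snd
  pair := Quotient.map₂ C.pair fun _ _ hf _ _ hg =>
    ⟨R.pair_congr hf.1 hg.1, R.pair_congr hf.2 hg.2⟩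
  fst_pair := by
    rintro X A B ⟨f⟩ ⟨g⟩
    exact congrArg (Quotient.mk _) (C.fst_pair f g)
  snd_pair := by
    rintro X A B ⟨f⟩ ⟨g⟩
    exact congrArg (Quotient.mk _) (C.snd_pair f g)
  pair_unique := by
    rintro X A B _ _ ⟨h⟩ rfl rfl
    exact congrArg (Quotient.mk _) (C.pair_eta h).symm
  eval := Quotient.mk _ C.eval
  curry := Quotient.map C.curry fun _ _ h => ⟨R.curry_congr h.1, R.curry_congr h.2⟩
  eval_curry := by
    rintro X A B ⟨f⟩
    exact congrArg (Quotient.mk _) (C.eval_curry f)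
  curry_unique := by
    rintro X A B _ ⟨h⟩ rfl
    exact congrArg (Quotient.mk _) (C.curry_eta h).symm
  le := Quotient.lift₂ R.r fun _ _ _ _ hf hg => propext
    ⟨fun h => R.r_trans hf.2 (R.r_trans h hg.1), fun h => R.r_trans hf.1 (R.r_trans h hg.2)⟩
  le_refl := by
    rintro A B ⟨f⟩
    exact R.r_refl f
  le_trans := by
    rintro A B ⟨f⟩ ⟨g⟩ ⟨h⟩ hfg hgh
    exact R.r_trans hfg hgh
  le_antisymm := by
    rintro A B ⟨f⟩ ⟨g⟩ hfg hgf
    exact Quotient.sound ⟨hfg, hgf⟩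
  bot := Quotient.mk _ C.bot
  bot_le := by
    rintro A B ⟨f⟩
    exact R.le_sub (C.bot_le f)
  comp_mono := by
    rintro A B X ⟨g⟩ ⟨g'⟩ ⟨f⟩ ⟨f'⟩ hg hf
    exact R.comp_congr hg hf
  pair_mono := by
    rintro X A B ⟨f⟩ ⟨f'⟩ ⟨g⟩ ⟨g'⟩ hf hg
    exact R.pair_congr hf hg
  curry_mono := by
    rintro X A B ⟨f⟩ ⟨g⟩ h
    exact R.curry_congr h
  bot_comp := by
    rintro A B X ⟨f⟩
    exact congrArg (Quotient.mk _) (C.bot_comp f)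
  iter {A B} f k := Quotient.map (sa := R.setoid (prod A B) B) (fun f => C.iter f k)
    (fun _ _ h => ⟨R.iter_congr h.1 k, R.iter_congr h.2 k⟩) f
  iter_zero := by
    rintro A B ⟨f⟩
    exact congrArg (Quotient.mk _) (C.iter_zero f)
  iter_succ := by
    rintro A B ⟨f⟩ k
    exact congrArg (Quotient.mk _) (C.iter_succ f k)
  fix := Quotient.map C.fix fun _ _ h => ⟨R.fix_congr h.1, R.fix_congr h.2⟩
  fix_lub := by
    rintro A B X Y ⟨f⟩ ⟨g⟩ ⟨h⟩
    refine ⟨fun k => R.le_sub ((C.fix_lub f g h).1 k), ?_⟩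
    rintro ⟨u⟩ hu
    exact R.rat_closed f g h u hu

end Precongruence

/-- The Rational Quotient Lemma (Lemma 4.2.1): if `≲` is a precongruence on a
rational cartesian closed category `C`, then the quotient category `C/≲` —
same objects, hom-posets `C(A,B)/≃` ordered by `[f] ≤ [g] iff f ≲ g`, with
composition, pairing and currying defined on equivalence classes by
`[g]∘[f] = [g∘f]`, `⟨[f],[g]⟩ = [⟨f,g⟩]`, `Λ([f]) = [Λ(f)]` — is again a
rational cartesian closed category. -/
theorem rational_quotient {Obj : Type u} {Hom : Obj → Obj → Type v}
    {one : Obj} {prod exp : Obj → Obj → Obj}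
    (C : RationalCCC Obj Hom one prod exp) (R : Precongruence C) :
    ∃ D : RationalCCC Obj (fun A B => Quotient (R.setoid A B)) one prod exp,
      (∀ {A B : Obj} (f g : Hom A B),
        D.le (Quotient.mk (R.setoid A B) f) (Quotient.mk (R.setoid A B) g) ↔ R.r f g) ∧
      (∀ A : Obj, D.id A = Quotient.mk (R.setoid A A) (C.id A)) ∧
      (∀ {A B C' : Obj} (g : Hom B C') (f : Hom A B),
        D.comp (Quotient.mk (R.setoid B C') g) (Quotient.mk (R.setoid A B) f) =
          Quotient.mk (R.setoid A C') (C.comp g f)) ∧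
      (∀ {C' A B : Obj} (f : Hom C' A) (g : Hom C' B),
        D.pair (Quotient.mk (R.setoid C' A) f) (Quotient.mk (R.setoid C' B) g) =
          Quotient.mk (R.setoid C' (prod A B)) (C.pair f g)) ∧
      (∀ {C' A B : Obj} (f : Hom (prod C' A) B),
        D.curry (Quotient.mk (R.setoid (prod C' A) B) f) =
          Quotient.mk (R.setoid C' (exp A B)) (C.curry f)) :=
  ⟨R.quotient, fun _ _ => Iff.rfl, fun _ => rfl, fun _ _ => rfl, fun _ _ => rfl, fun _ => rfl⟩
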